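/- arXiv:math/0406364 — 2 statements merged into one kernel-verified Lean document; each statement's English description precedes it below -/
import Mathlib

section
/- Let 𝒳 be a compact metric space and let (μ_n)_{n≥1} be an exchangeable triangular array of Borel probability measures, μ_n on 𝒳^n (i.e., T̃^n_k μ_n = μ_k for all k ≤ n). Then each μ_n is invariant under the natural action of the symmetric group S_n on 𝒳^n, and the sequence (μ_n)_{n≥1} is thinning-invariant: T^n_k μ_n = μ_k for all k ≤ n. -/
open MeasureTheory
open scoped ENNReal

/-- The thinning transition `T^n_k : M₁(𝒳ⁿ) → M₁(𝒳ᵏ)`: the average over all strictly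
increasing index maps `ι : Fin k → Fin n` of the pushforward of `μ` under `x ↦ x ∘ ι`. -/
noncomputable def thinTrans {X : Type*} [MeasurableSpace X] (k n : ℕ)
    (μ : Measure (Fin n → X)) : Measure (Fin k → X) :=
  ((n.choose k : ℝ≥0∞))⁻¹ •
    Measure.sum (fun ι : {ι : Fin k → Fin n // StrictMono ι} =>
      Measure.map (fun x => x ∘ ι.1) μ)

/-- The shuffled thinning transition `T̃^n_k : M₁(𝒳ⁿ) → M₁(𝒳ᵏ)`: the average over all
strictly increasing index maps `ι : Fin k → Fin n` and all permutations `π ∈ S_k` of the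
pushforward of `μ` under `x ↦ (j ↦ x (ι (π j)))`. -/
noncomputable def shuffledThinTrans {X : Type*} [MeasurableSpace X] (k n : ℕ)
    (μ : Measure (Fin n → X)) : Measure (Fin k → X) :=
  ((n.choose k * Nat.factorial k : ℝ≥0∞))⁻¹ •
    Measure.sum
      (fun p : {ι : Fin k → Fin n // StrictMono ι} × Equiv.Perm (Fin k) =>
        Measure.map (fun x j => x (p.1.1 (p.2 j))) μ)

theorem map_perm_shuffledThinTrans {X : Type*} [MeasurableSpace X] (k n : ℕ)
    (μ : Measure (Fin n → X)) (σ : Equiv.Perm (Fin k)) :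
    Measure.map (fun x : Fin k → X => fun i => x (σ i)) (shuffledThinTrans k n μ) =
      shuffledThinTrans k n μ := by
  unfold shuffledThinTrans
  rw [Measure.map_smul, Measure.map_sum (Measurable.aemeasurable (by fun_prop))]
  congr 1
  ext s hs
  rw [Measure.sum_apply _ hs, Measure.sum_apply _ hs]
  conv_rhs => rw [← ((Equiv.refl _).prodCongr (Equiv.mulRight σ)).tsum_eq]
  refine tsum_congr fun p => ?_
  rw [Measure.map_map (by fun_prop) (by fun_prop)]
  rfl

theorem map_comp_embedding_perm {ι κ X : Type*} [MeasurableSpace X] {μ : Measure (κ → X)}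
    (hμ : ∀ σ : Equiv.Perm κ, Measure.map (fun x : κ → X => fun i => x (σ i)) μ = μ)
    (f : ι ↪ κ) (π : Equiv.Perm ι) :
    Measure.map (fun (x : κ → X) j => x (f (π j))) μ = Measure.map (fun x => x ∘ f) μ := by
  conv_rhs => rw [← hμ (π.viaEmbedding f)]
  rw [Measure.map_map (by fun_prop) (by fun_prop)]
  congr 1
  funext x j
  simp [Equiv.Perm.viaEmbedding_apply]

theorem shuffledThinTrans_eq_thinTrans {X : Type*} [MeasurableSpace X] (k n : ℕ)
    {μ : Measure (Fin n → X)}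
    (hμ : ∀ σ : Equiv.Perm (Fin n),
      Measure.map (fun x : Fin n → X => fun i => x (σ i)) μ = μ) :
    shuffledThinTrans k n μ = thinTrans k n μ := by
  have hk : (k.factorial : ℝ≥0∞) ≠ 0 := by exact_mod_cast k.factorial_ne_zero
  have hmap (p : {ι : Fin k → Fin n // StrictMono ι} × Equiv.Perm (Fin k)) :
      Measure.map (fun (x : Fin n → X) j => x (p.1.1 (p.2 j))) μ =
        Measure.map (fun x => x ∘ p.1.1) μ :=
    map_comp_embedding_perm hμ ⟨p.1.1, p.1.2.injective⟩ p.2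
  ext s hs
  simp only [shuffledThinTrans, thinTrans, hmap, Measure.smul_apply, Measure.sum_apply _ hs,
    smul_eq_mul, tsum_fintype, Fintype.sum_prod_type, Finset.sum_const, Finset.card_univ,
    Fintype.card_perm, Fintype.card_fin, nsmul_eq_mul, ← Finset.mul_sum]
  rw [ENNReal.mul_inv (.inr (ENNReal.natCast_ne_top _)) (.inl (ENNReal.natCast_ne_top _)),
    mul_assoc, ENNReal.inv_mul_cancel_left hk (ENNReal.natCast_ne_top _)]

/-- **Exchangeable triangular arrays are symmetric and thinning invariant.**
If `T̃^n_k μ_n = μ_k` for all `1 ≤ k ≤ n`, then each `μ_n` is invariant under the natural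
action of the symmetric group `S_n` on `𝒳ⁿ`, and the sequence is thinning invariant:
`T^n_k μ_n = μ_k` for all `1 ≤ k ≤ n`. -/
theorem exchangeable_symmetric_and_thinning_invariant
    {X : Type*} [MetricSpace X] [CompactSpace X] [MeasurableSpace X] [BorelSpace X]
    (μ : (n : ℕ) → Measure (Fin n → X))
    (hprob : ∀ n, 1 ≤ n → IsProbabilityMeasure (μ n))
    (hexch : ∀ k n, 1 ≤ k → k ≤ n → shuffledThinTrans k n (μ n) = μ k) :
    (∀ n, 1 ≤ n → ∀ π : Equiv.Perm (Fin n),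
      Measure.map (fun x : Fin n → X => fun i => x (π i)) (μ n) = μ n) ∧
    (∀ k n, 1 ≤ k → k ≤ n → thinTrans k n (μ n) = μ k) := by
  have hsymm : ∀ n, 1 ≤ n → ∀ π : Equiv.Perm (Fin n),
      Measure.map (fun x : Fin n → X => fun i => x (π i)) (μ n) = μ n := fun n hn π => by
    rw [← hexch n n hn le_rfl]
    exact map_perm_shuffledThinTrans n n (μ n) π
  refine ⟨hsymm, fun k n hk hkn => ?_⟩
  rw [← shuffledThinTrans_eq_thinTrans k n (hsymm n (hk.trans hkn)), hexch k n hk hkn]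
end

section
/- Fix an integer n ≥ 1, a function φ_n : {−1,+1}^n → ℝ, and β ∈ [0,∞). For N ≥ n define H_N(σ) = N·C(N,n)⁻¹ Σ_{1≤i₁<⋯<i_n≤N} φ_n(σ_{i₁},…,σ_{i_n}) on {−1,+1}^N, the normalized partition function Z_N(β) = 2^{−N} Σ_{σ∈{−1,+1}^N} exp(−β H_N(σ)), and Ω_N(β) = log Z_N(β). Then for all integers N₁, N₂ ≥ n: Ω_{N₁+N₂}(β) ≤ Ω_{N₁}(β) + Ω_{N₂}(β). -/
open scoped Classical in
/-- The finset of strictly increasing maps `Fin n → Fin m`. -/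
noncomputable def strictMonoMaps (n m : ℕ) : Finset (Fin n → Fin m) :=
  Finset.univ.filter StrictMono

/-- The oriented mean-field Hamiltonian on `m` Ising spins built from the `n`-body
interaction `φ`: `H_m(σ) = m·C(m,n)⁻¹ Σ_{i₁<⋯<i_n} φ(σ_{i₁},…,σ_{i_n})`. -/
noncomputable def mfHamiltonian (n m : ℕ) (φ : (Fin n → ℤˣ) → ℝ)
    (σ : Fin m → ℤˣ) : ℝ :=
  (m : ℝ) * ((m.choose n : ℝ))⁻¹ * ∑ ι ∈ strictMonoMaps n m, φ (σ ∘ ι)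

/-- The normalized partition function `Z_m(β) = 2^{−m} Σ_σ exp(−β H_m(σ))`. -/
noncomputable def mfPartition (n : ℕ) (φ : (Fin n → ℤˣ) → ℝ) (β : ℝ) (m : ℕ) : ℝ :=
  ((2 : ℝ) ^ m)⁻¹ * ∑ σ : Fin m → ℤˣ, Real.exp (-β * mfHamiltonian n m φ σ)

/-- The thermodynamic potential `Ω_m(β) = log Z_m(β)`. -/
noncomputable def mfPotential (n : ℕ) (φ : (Fin n → ℤˣ) → ℝ) (β : ℝ) (m : ℕ) : ℝ :=
  Real.log (mfPartition n φ β m)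

lemma mem_strictMonoMaps {n m : ℕ} {ι : Fin n → Fin m} : ι ∈ strictMonoMaps n m ↔ StrictMono ι := by
  simp [strictMonoMaps]

lemma card_strictMono_image {n N : ℕ} {ι : Fin n → Fin N} (hι : StrictMono ι) :
    (Finset.univ.image ι).card = n := by
  simp [Finset.card_image_of_injective _ hι.injective]

/-- Strictly increasing maps into `Fin m` correspond to strictly increasing maps into an
`m`-element subset of `Fin N`. -/
lemma sum_strictMonoMaps_orderEmbOfFin {n m N : ℕ} (S : Finset (Fin N)) (hS : S.card = m)
    (g : (Fin n → Fin N) → ℝ) :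
    ∑ κ ∈ strictMonoMaps n m, g (S.orderEmbOfFin hS ∘ κ) =
      ∑ ι ∈ strictMonoMaps n N, if Finset.univ.image ι ⊆ S then g ι else 0 := by
  rw [← Finset.sum_filter]
  refine Finset.sum_bij (fun κ _ => S.orderEmbOfFin hS ∘ κ) ?_ ?_ ?_ (fun _ _ => rfl)
  · intro κ hκ
    rw [mem_strictMonoMaps] at hκ
    simp only [Finset.mem_filter, mem_strictMonoMaps]
    refine ⟨(S.orderEmbOfFin hS).strictMono.comp hκ, ?_⟩
    intro x hx
    obtain ⟨j, -, rfl⟩ := Finset.mem_image.1 hx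
    exact S.orderEmbOfFin_mem hS _
  · intro κ _ κ' _ h
    exact (S.orderEmbOfFin hS).injective.comp_left h
  · intro ι hι
    simp only [Finset.mem_filter, mem_strictMonoMaps] at hι
    obtain ⟨hmono, hsub⟩ := hι
    have hex : ∀ j, ∃ k, S.orderEmbOfFin hS k = ι j := fun j => by
      have : ι j ∈ Set.range (S.orderEmbOfFin hS) := by
        rw [S.range_orderEmbOfFin hS]
        exact hsub (Finset.mem_image_of_mem _ (Finset.mem_univ j))
      exact this
    choose κ hκ using hex
    refine ⟨κ, mem_strictMonoMaps.2 fun a b hab => ?_, funext hκ⟩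
    rw [← (S.orderEmbOfFin hS).lt_iff_lt, hκ, hκ]
    exact hmono hab

lemma card_powersetCard_filter_superset {α : Type*} [Fintype α] [DecidableEq α]
    (T : Finset α) {m : ℕ} (hT : T.card ≤ m) (hm : m ≤ Fintype.card α) :
    ((Finset.powersetCard m (Finset.univ : Finset α)).filter (T ⊆ ·)).card =
      (Fintype.card α - T.card).choose (m - T.card) := by
  have : ((Finset.powersetCard m (Finset.univ : Finset α)).filter (T ⊆ ·)).card =
      (Finset.powersetCard (Fintype.card α - m) Tᶜ).card := by
    refine Finset.card_nbij' (·ᶜ) (·ᶜ) ?_ ?_ (by simp [Set.LeftInvOn]) (by simp [Set.LeftInvOn])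
    · intro S hS
      simp only [Finset.coe_filter, Finset.mem_powersetCard, Set.mem_ofPred_eq] at hS
      simp only [Finset.mem_coe, Finset.mem_powersetCard, Finset.compl_subset_compl,
        Finset.card_compl]
      exact ⟨hS.2, by rw [hS.1.2]⟩
    · intro S hS
      simp only [Finset.mem_coe, Finset.mem_powersetCard] at hS
      simp only [Finset.coe_filter, Finset.mem_powersetCard, Set.mem_ofPred_eq,
        Finset.card_compl, Finset.subset_univ, true_and]
      exact ⟨by omega, Finset.subset_compl_comm.1 hS.1⟩
  rw [this, Finset.card_powersetCard, Finset.card_compl]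
  apply Nat.choose_symm_of_eq_add
  omega

/-- Averaging the Hamiltonian of an `m`-spin subsystem over all `m`-element subsets. -/
lemma sum_mfHamiltonian_comp_orderEmbOfFin {n m N : ℕ} (hn : n ≤ m) (hm : m ≤ N)
    (φ : (Fin n → ℤˣ) → ℝ) (σ : Fin N → ℤˣ) :
    ∑ S : {S : Finset (Fin N) // S.card = m},
        mfHamiltonian n m φ (σ ∘ S.1.orderEmbOfFin S.2) =
      (N.choose m : ℝ) *
        ((m : ℝ) * (N.choose n : ℝ)⁻¹ * ∑ ι ∈ strictMonoMaps n N, φ (σ ∘ ι)) := by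
  have hcount : ∀ ι ∈ strictMonoMaps n N,
      (∑ S : {S : Finset (Fin N) // S.card = m},
        if Finset.univ.image ι ⊆ S.1 then φ (σ ∘ ι) else 0) =
      ((N - n).choose (m - n) : ℝ) * φ (σ ∘ ι) := by
    intro ι hι
    have hc := card_strictMono_image (mem_strictMonoMaps.1 hι)
    rw [← Finset.sum_subtype (Finset.powersetCard m Finset.univ)
      (fun S => by simp [Finset.mem_powersetCard])
      (fun S => if Finset.univ.image ι ⊆ S then φ (σ ∘ ι) else 0), ← Finset.sum_filter,
      Finset.sum_const, card_powersetCard_filter_superset _ (hc.trans_le hn) (by simpa using hm),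
      hc, Fintype.card_fin, nsmul_eq_mul]
  have hchoose : (N.choose m : ℝ) * m.choose n = N.choose n * (N - n).choose (m - n) := by
    exact_mod_cast Nat.choose_mul hn
  have h1 : (m.choose n : ℝ) ≠ 0 := by exact_mod_cast (Nat.choose_pos hn).ne'
  have h2 : (N.choose n : ℝ) ≠ 0 := by exact_mod_cast (Nat.choose_pos (hn.trans hm)).ne'
  simp only [mfHamiltonian, Function.comp_assoc]
  rw [← Finset.mul_sum]
  simp_rw [sum_strictMonoMaps_orderEmbOfFin _ _ fun ι => φ (σ ∘ ι)]
  rw [Finset.sum_comm, Finset.sum_congr rfl hcount, ← Finset.mul_sum]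
  field_simp
  linear_combination -(m * ∑ ι ∈ strictMonoMaps n N, φ (σ ∘ ι)) * hchoose

lemma card_compl_of_card_eq {N₁ N₂ : ℕ} {S : Finset (Fin (N₁ + N₂))} (hS : S.card = N₁) :
    Sᶜ.card = N₂ := by
  simp [Finset.card_compl, hS]

/-- The Hamiltonian of `N₁ + N₂` spins is the average, over all splittings into subsystems of
`N₁` and `N₂` spins, of the sum of the Hamiltonians of the subsystems. -/
lemma mfHamiltonian_add_eq_average {n N₁ N₂ : ℕ} (h₁ : n ≤ N₁) (h₂ : n ≤ N₂)
    (φ : (Fin n → ℤˣ) → ℝ) (σ : Fin (N₁ + N₂) → ℤˣ) :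
    mfHamiltonian n (N₁ + N₂) φ σ =
      ∑ S : {S : Finset (Fin (N₁ + N₂)) // S.card = N₁}, ((N₁ + N₂).choose N₁ : ℝ)⁻¹ *
        (mfHamiltonian n N₁ φ (σ ∘ S.1.orderEmbOfFin S.2) +
          mfHamiltonian n N₂ φ (σ ∘ S.1ᶜ.orderEmbOfFin (card_compl_of_card_eq S.2))) := by
  let e : {S : Finset (Fin (N₁ + N₂)) // S.card = N₁} ≃
      {S : Finset (Fin (N₁ + N₂)) // S.card = N₂} :=
    { toFun := fun S => ⟨S.1ᶜ, card_compl_of_card_eq S.2⟩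
      invFun := fun S => ⟨S.1ᶜ, by simp [Finset.card_compl, S.2]⟩
      left_inv := fun S => by simp
      right_inv := fun S => by simp }
  have hcompl := e.sum_comp fun S => mfHamiltonian n N₂ φ (σ ∘ S.1.orderEmbOfFin S.2)
  rw [sum_mfHamiltonian_comp_orderEmbOfFin h₂ (Nat.le_add_left _ _)] at hcompl
  rw [← Finset.mul_sum, Finset.sum_add_distrib,
    sum_mfHamiltonian_comp_orderEmbOfFin h₁ (Nat.le_add_right _ _)]
  refine Eq.trans ?_ (congrArg (fun x => _ * (_ + x)) hcompl.symm)
  have hsymm : (N₁ + N₂).choose N₂ = (N₁ + N₂).choose N₁ := Nat.choose_symm_add.symm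
  have hpos : ((N₁ + N₂).choose N₁ : ℝ) ≠ 0 := by
    exact_mod_cast (Nat.choose_pos (Nat.le_add_right _ _)).ne'
  rw [hsymm, mfHamiltonian]
  push_cast
  field_simp

lemma sum_mul_comp_orderEmbOfFin {N₁ N₂ : ℕ} (S : Finset (Fin (N₁ + N₂))) (hS : S.card = N₁)
    (f : (Fin N₁ → ℤˣ) → ℝ) (g : (Fin N₂ → ℤˣ) → ℝ) :
    ∑ σ : Fin (N₁ + N₂) → ℤˣ, f (σ ∘ S.orderEmbOfFin hS) *
        g (σ ∘ Sᶜ.orderEmbOfFin (card_compl_of_card_eq hS)) =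
      (∑ σ, f σ) * ∑ σ, g σ := by
  let e : (Fin (N₁ + N₂) → ℤˣ) ≃ (Fin N₁ → ℤˣ) × (Fin N₂ → ℤˣ) :=
    ((finSumEquivOfFinset hS (card_compl_of_card_eq hS)).symm.arrowCongr (Equiv.refl _)).trans
      (Equiv.sumArrowEquivProdArrow _ _ _)
  rw [Finset.sum_mul_sum, ← Fintype.sum_prod_type' fun σ τ => f σ * g τ, ← e.sum_comp]
  rfl

lemma mfPartition_pos (n : ℕ) (φ : (Fin n → ℤˣ) → ℝ) (β : ℝ) (m : ℕ) :
    0 < mfPartition n φ β m := by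
  unfold mfPartition
  exact mul_pos (by positivity) (Finset.sum_pos (fun _ _ => Real.exp_pos _) Finset.univ_nonempty)

lemma mfPartition_add_le {n : ℕ} (φ : (Fin n → ℤˣ) → ℝ) (β : ℝ) {N₁ N₂ : ℕ}
    (h₁ : n ≤ N₁) (h₂ : n ≤ N₂) :
    mfPartition n φ β (N₁ + N₂) ≤ mfPartition n φ β N₁ * mfPartition n φ β N₂ := by
  have hpos : (0 : ℝ) < (N₁ + N₂).choose N₁ := by
    exact_mod_cast Nat.choose_pos (Nat.le_add_right _ _)
  have hcard : Fintype.card {S : Finset (Fin (N₁ + N₂)) // S.card = N₁} =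
      (N₁ + N₂).choose N₁ := by simp
  have hexp (σ : Fin (N₁ + N₂) → ℤˣ) : Real.exp (-β * mfHamiltonian n (N₁ + N₂) φ σ) ≤
      ∑ S : {S : Finset (Fin (N₁ + N₂)) // S.card = N₁}, ((N₁ + N₂).choose N₁ : ℝ)⁻¹ *
        (Real.exp (-β * mfHamiltonian n N₁ φ (σ ∘ S.1.orderEmbOfFin S.2)) *
          Real.exp (-β * mfHamiltonian n N₂ φ
            (σ ∘ S.1ᶜ.orderEmbOfFin (card_compl_of_card_eq S.2)))) := by
    rw [mfHamiltonian_add_eq_average h₁ h₂, Finset.mul_sum]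
    simp_rw [← Real.exp_add, ← mul_add, mul_left_comm (-β)]
    refine convexOn_exp.map_sum_le (fun _ _ => by positivity) ?_ (fun _ _ => Set.mem_univ _)
    rw [Finset.sum_const, Finset.card_univ, hcard, nsmul_eq_mul, mul_inv_cancel₀ hpos.ne']
  have hsum := Finset.sum_le_sum fun σ (_ : σ ∈ Finset.univ) => hexp σ
  rw [Finset.sum_comm] at hsum
  simp only [← Finset.mul_sum] at hsum
  rw [Finset.sum_congr rfl fun (S : {S : Finset (Fin (N₁ + N₂)) // S.card = N₁}) _ =>
    sum_mul_comp_orderEmbOfFin S.1 S.2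
      (fun σ => Real.exp (-β * mfHamiltonian n N₁ φ σ))
      (fun σ => Real.exp (-β * mfHamiltonian n N₂ φ σ)),
    Finset.sum_const, Finset.card_univ, hcard, nsmul_eq_mul, inv_mul_cancel_left₀ hpos.ne'] at hsum
  unfold mfPartition
  calc _ ≤ _ := mul_le_mul_of_nonneg_left hsum (by positivity)
    _ = _ := by rw [pow_add, mul_inv]; ring

/-- **Subadditivity of the thermodynamic potential** for oriented mean-field spin chains:
for `N₁, N₂ ≥ n`, `Ω_{N₁+N₂}(β) ≤ Ω_{N₁}(β) + Ω_{N₂}(β)`. -/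
theorem mfPotential_subadditive
    (n : ℕ) (hn : 1 ≤ n) (φ : (Fin n → ℤˣ) → ℝ) (β : ℝ) (hβ : 0 ≤ β)
    (N₁ N₂ : ℕ) (h₁ : n ≤ N₁) (h₂ : n ≤ N₂) :
    mfPotential n φ β (N₁ + N₂) ≤ mfPotential n φ β N₁ + mfPotential n φ β N₂ := by
  rw [mfPotential, mfPotential, mfPotential,
    ← Real.log_mul (mfPartition_pos n φ β N₁).ne' (mfPartition_pos n φ β N₂).ne']
  exact Real.log_le_log (mfPartition_pos n φ β _) (mfPartition_add_le φ β h₁ h₂)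
end
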